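/- Let x ∈ B_n be a left rigid braid with ℓ(x) = r > 1. Then Φ, defined on vertices by Φ(y) = c_R^{2rt}(y) (for t with c_R^{2rt}(y) right rigid) and on arrows by iterated right transport, is a well-defined map of directed graphs from USG_L(x) to USG_R(x)^op: for every arrow labeled s from u to v in USG_L(x), its iterated right transport Φ(s) = s^{(2rt)}_R is a simple element with Φ(s)·Φ(v)·Φ(s)⁻¹ = Φ(u), i.e. an arrow from Φ(u) to Φ(v) in USG_R(x)^op. -/

import Mathlib

/-!
Axiomatization of Garside groups (positive cone, Garside element, lattice
structure, left/right normal forms), following the paper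
"On the cycling operation in braid groups" by Gebhardt and González-Meneses.
-/

namespace Garside

variable {G : Type*} [Group G]

/-- `a ≼ b`: `a` is a left divisor (prefix) of `b` w.r.t. the positive cone `P`. -/
def LeftDvd (P : Submonoid G) (a b : G) : Prop := a⁻¹ * b ∈ P

/-- `a` is a right divisor (suffix) of `b` w.r.t. the positive cone `P`
(i.e. `b ≽ a` in the notation of the paper). -/
def RightDvd (P : Submonoid G) (a b : G) : Prop := b * a⁻¹ ∈ P

/-- A simple element: a positive prefix of `Δ`. -/
def Simple (P : Submonoid G) (Δ : G) (s : G) : Prop := s ∈ P ∧ LeftDvd P s Δ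

/-- An atom: a nontrivial positive element which is not the product
of two nontrivial positive elements. -/
def Atom (P : Submonoid G) (a : G) : Prop :=
  a ∈ P ∧ a ≠ 1 ∧ ∀ b c : G, b ∈ P → c ∈ P → a = b * c → b = 1 ∨ c = 1

/-- `Δ^p x₁ ⋯ x_r` (with `l = [x₁,…,x_r]`) is the left normal form of `x`:
each factor is a proper simple element and consecutive factors are
left-weighted, `x_i = (x_i x_{i+1}) ∧_L Δ`. -/
def IsLeftNF (P : Submonoid G) (Δ : G) (gcdL : G → G → G) (p : ℤ) (l : List G) (x : G) :
    Prop :=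
  x = Δ ^ p * l.prod ∧ (∀ s ∈ l, Simple P Δ s ∧ s ≠ 1 ∧ s ≠ Δ) ∧
    l.Chain' (fun s t => gcdL (s * t) Δ = s)

/-- `y₁ ⋯ y_r Δ^p` (with `l = [y₁,…,y_r]`) is the right normal form of `x`:
each factor is a proper simple element and consecutive factors are
right-weighted, `y_{i+1} = (y_i y_{i+1}) ∧_R Δ`. -/
def IsRightNF (P : Submonoid G) (Δ : G) (gcdR : G → G → G) (p : ℤ) (l : List G) (x : G) :
    Prop :=
  x = l.prod * Δ ^ p ∧ (∀ s ∈ l, Simple P Δ s ∧ s ≠ 1 ∧ s ≠ Δ) ∧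
    l.Chain' (fun s t => gcdR (s * t) Δ = t)

/-- A Garside structure on a group `G`: a positive cone which induces lattice
orders by left and right divisibility, and a Garside element `Δ` whose left and
right divisors coincide (the simple elements), generate the group, and such that
every element admits a unique left and right normal form. -/
structure GarsideGroup (G : Type*) [Group G] where
  pos : Submonoid G
  pos_antisymm : ∀ a : G, a ∈ pos → a⁻¹ ∈ pos → a = 1
  Δ : G
  Δ_pos : Δ ∈ pos
  gcdL : G → G → G
  gcdL_dvd_left : ∀ a b : G, LeftDvd pos (gcdL a b) a
  gcdL_dvd_right : ∀ a b : G, LeftDvd pos (gcdL a b) b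
  dvd_gcdL : ∀ a b c : G, LeftDvd pos c a → LeftDvd pos c b → LeftDvd pos c (gcdL a b)
  lcmL : G → G → G
  dvd_lcmL_left : ∀ a b : G, LeftDvd pos a (lcmL a b)
  dvd_lcmL_right : ∀ a b : G, LeftDvd pos b (lcmL a b)
  lcmL_dvd : ∀ a b c : G, LeftDvd pos a c → LeftDvd pos b c → LeftDvd pos (lcmL a b) c
  gcdR : G → G → G
  gcdR_dvd_left : ∀ a b : G, RightDvd pos (gcdR a b) a
  gcdR_dvd_right : ∀ a b : G, RightDvd pos (gcdR a b) b
  dvd_gcdR : ∀ a b c : G, RightDvd pos c a → RightDvd pos c b → RightDvd pos c (gcdR a b)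
  lcmR : G → G → G
  dvd_lcmR_left : ∀ a b : G, RightDvd pos a (lcmR a b)
  dvd_lcmR_right : ∀ a b : G, RightDvd pos b (lcmR a b)
  lcmR_dvd : ∀ a b c : G, RightDvd pos a c → RightDvd pos b c → RightDvd pos (lcmR a b) c
  divisors_Δ : ∀ s : G, (s ∈ pos ∧ LeftDvd pos s Δ) ↔ (s ∈ pos ∧ RightDvd pos s Δ)
  simples_generate : Subgroup.closure {s : G | Simple pos Δ s} = ⊤
  lnf_exists : ∀ x : G, ∃ pl : ℤ × List G, IsLeftNF pos Δ gcdL pl.1 pl.2 x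
  lnf_unique : ∀ (x : G) (p q : ℤ) (l m : List G),
    IsLeftNF pos Δ gcdL p l x → IsLeftNF pos Δ gcdL q m x → p = q ∧ l = m
  rnf_exists : ∀ x : G, ∃ pl : ℤ × List G, IsRightNF pos Δ gcdR pl.1 pl.2 x
  rnf_unique : ∀ (x : G) (p q : ℤ) (l m : List G),
    IsRightNF pos Δ gcdR p l x → IsRightNF pos Δ gcdR q m x → p = q ∧ l = m
  lnf_rnf_agree : ∀ (x : G) (p q : ℤ) (l m : List G),
    IsLeftNF pos Δ gcdL p l x → IsRightNF pos Δ gcdR q m x → p = q ∧ l.length = m.length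

/-- `L` is the left lcm of the set `S`. -/
def IsLcmL (P : Submonoid G) (S : Set G) (L : G) : Prop :=
  (∀ a ∈ S, LeftDvd P a L) ∧ ∀ c : G, (∀ a ∈ S, LeftDvd P a c) → LeftDvd P L c

/-- A Garside group is atom-friendly (on the left) if `Δ` is the left lcm of the
set of atoms and the starting set of the left lcm of any set `B` of atoms is `B`. -/
def AtomFriendlyL (𝒢 : GarsideGroup G) : Prop :=
  IsLcmL 𝒢.pos {a : G | Atom 𝒢.pos a} 𝒢.Δ ∧
    ∀ B : Set G, B ⊆ {a : G | Atom 𝒢.pos a} →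
      ∃ L : G, IsLcmL 𝒢.pos B L ∧ {a : G | Atom 𝒢.pos a ∧ LeftDvd 𝒢.pos a L} = B

namespace GarsideGroup

variable (𝒢 : GarsideGroup G)

/-- The left normal form of `x`, as a pair (infimum, list of factors). -/
noncomputable def lnf (x : G) : ℤ × List G := Classical.choose (𝒢.lnf_exists x)

/-- The right normal form of `x`, as a pair (exponent of `Δ`, list of factors). -/
noncomputable def rnf (x : G) : ℤ × List G := Classical.choose (𝒢.rnf_exists x)

/-- `inf x = p`, the maximal `p` with `Δ^p ≼ x`. -/
noncomputable def inf (x : G) : ℤ := (𝒢.lnf x).1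

/-- The canonical length `ℓ(x) = r`. -/
noncomputable def len (x : G) : ℕ := (𝒢.lnf x).2.length

/-- `sup x = p + r`. -/
noncomputable def sup (x : G) : ℤ := 𝒢.inf x + 𝒢.len x

/-- `tau 𝒢 k x = τ^k(x) = Δ^{-k} x Δ^k`. -/
def tau (k : ℤ) (x : G) : G := 𝒢.Δ ^ (-k) * x * 𝒢.Δ ^ k

/-- The left initial factor `ι_L(x) = τ^{-p}(x₁)` (equal to `1` if `ℓ(x) = 0`). -/
noncomputable def iotaL (x : G) : G := 𝒢.tau (-(𝒢.lnf x).1) ((𝒢.lnf x).2.headD 1)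

/-- The right initial factor `ι_R(x) = τ^{p}(y_r)` (equal to `1` if `ℓ(x) = 0`). -/
noncomputable def iotaR (x : G) : G := 𝒢.tau (𝒢.rnf x).1 (((𝒢.rnf x).2.getLast?).getD 1)

/-- Left cycling: `c_L(x) = ι_L(x)⁻¹ · x · ι_L(x)`. -/
noncomputable def cL (x : G) : G := (𝒢.iotaL x)⁻¹ * x * 𝒢.iotaL x

/-- Right cycling: `c_R(x) = ι_R(x) · x · ι_R(x)⁻¹`. -/
noncomputable def cR (x : G) : G := 𝒢.iotaR x * x * (𝒢.iotaR x)⁻¹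

/-- `x = Δ^p x₁⋯x_r` (in left normal form, `r > 0`) is left rigid if
`Δ^p x₁⋯x_r ι_L(x)` is in left normal form as written. -/
def LeftRigid (x : G) : Prop :=
  (𝒢.lnf x).2 ≠ [] ∧
    IsLeftNF 𝒢.pos 𝒢.Δ 𝒢.gcdL (𝒢.lnf x).1 ((𝒢.lnf x).2 ++ [𝒢.iotaL x]) (x * 𝒢.iotaL x)

/-- `x = y₁⋯y_r Δ^p` (in right normal form, `r > 0`) is right rigid if
`ι_R(x) y₁⋯y_r Δ^p` is in right normal form as written. -/
def RightRigid (x : G) : Prop :=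
  (𝒢.rnf x).2 ≠ [] ∧
    IsRightNF 𝒢.pos 𝒢.Δ 𝒢.gcdR (𝒢.rnf x).1 (𝒢.iotaR x :: (𝒢.rnf x).2) (𝒢.iotaR x * x)

/-- The super summit set: conjugates of minimal canonical length. -/
def SSS (x : G) : Set G :=
  {y | IsConj x y ∧ ∀ z : G, IsConj x z → 𝒢.len y ≤ 𝒢.len z}

/-- The left ultra summit set. -/
def USSL (x : G) : Set G :=
  {y ∈ 𝒢.SSS x | ∃ t : ℕ, 1 ≤ t ∧ (𝒢.cL)^[t] y = y}

/-- The right ultra summit set. -/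
def USSR (x : G) : Set G :=
  {y ∈ 𝒢.SSS x | ∃ t : ℕ, 1 ≤ t ∧ (𝒢.cR)^[t] y = y}

/-- `x` is periodically geodesic: `inf(x^m) = m inf(x)` and `sup(x^m) = m sup(x)`
for all `m ≥ 1`. -/
def PeriodicallyGeodesic (x : G) : Prop :=
  ∀ m : ℕ, 1 ≤ m → 𝒢.inf (x ^ m) = (m : ℤ) * 𝒢.inf x ∧ 𝒢.sup (x ^ m) = (m : ℤ) * 𝒢.sup x

/-- The left interior `x°_L = x Δ^{-p}`, where `p = inf(x)`. -/
noncomputable def intL (x : G) : G := x * 𝒢.Δ ^ (-𝒢.inf x)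

/-- The right interior `x°_R = Δ^{-p} x`, where `p = inf(x)`. -/
noncomputable def intR (x : G) : G := 𝒢.Δ ^ (-𝒢.inf x) * x

/-- The right transport of `v` (where `v x v⁻¹ = z`):
`v^{(1)}_R = ι_R(z) · v · ι_R(x)⁻¹`. -/
noncomputable def transR (x v : G) : G := 𝒢.iotaR (v * x * v⁻¹) * v * (𝒢.iotaR x)⁻¹

/-- The iterated right transport `v^{(i)}_R` of `v` along the right cyclings of `x`. -/
noncomputable def transRIter (x : G) : ℕ → G → G
  | 0, v => v
  | i + 1, v => 𝒢.transR ((𝒢.cR)^[i] x) (transRIter x i v)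

/-- Arrows of the left ultra summit graph `USG_L(x)`: triples `(u, s, v)` with
`u, v ∈ USS_L(x)`, `s` simple and `s⁻¹ u s = v`. -/
def ArrL (x : G) : Set (G × G × G) :=
  {a | a.1 ∈ 𝒢.USSL x ∧ a.2.2 ∈ 𝒢.USSL x ∧ Simple 𝒢.pos 𝒢.Δ a.2.1 ∧
    a.2.1⁻¹ * a.1 * a.2.1 = a.2.2}

/-- Arrows of the right ultra summit graph `USG_R(x)`: triples `(u, s, v)` with
`u, v ∈ USS_R(x)`, `s` simple and `s u s⁻¹ = v`. -/
def ArrR (x : G) : Set (G × G × G) :=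
  {a | a.1 ∈ 𝒢.USSR x ∧ a.2.2 ∈ 𝒢.USSR x ∧ Simple 𝒢.pos 𝒢.Δ a.2.1 ∧
    a.2.1 * a.1 * a.2.1⁻¹ = a.2.2}

/-- `PathFrom A u l`: the list of arrows `l` forms a directed path in the
graph with arrow set `A`, starting at the vertex `u`. -/
def PathFrom (A : Set (G × G × G)) : G → List (G × G × G) → Prop
  | _, [] => True
  | u, a :: rest => a ∈ A ∧ a.1 = u ∧ PathFrom A a.2.2 rest

/-- Minimal arrows of `USG_L(x)`: arrows whose label is not a product of the
labels of a directed path of length at least 2 starting at the same vertex. -/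
def MinArrL (x : G) : Set (G × G × G) :=
  {a | a ∈ 𝒢.ArrL x ∧ ¬ ∃ l : List (G × G × G), 2 ≤ l.length ∧
    PathFrom (𝒢.ArrL x) a.1 l ∧ (l.map (fun b => b.2.1)).prod = a.2.1}

/-- Minimal arrows of `USG_R(x)`. -/
def MinArrR (x : G) : Set (G × G × G) :=
  {a | a ∈ 𝒢.ArrR x ∧ ¬ ∃ l : List (G × G × G), 2 ≤ l.length ∧
    PathFrom (𝒢.ArrR x) a.1 l ∧ (l.map (fun b => b.2.1)).prod = a.2.1}

end GarsideGroup

end Garside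

namespace Garside

/-- The braid relations on `m` generators `σ₀, …, σ_{m-1}`:
`σᵢσⱼ = σⱼσᵢ` for `|i-j| > 1` and `σᵢσⱼσᵢ = σⱼσᵢσⱼ` for `|i-j| = 1`. -/
def braidRels (m : ℕ) : Set (FreeGroup (Fin m)) :=
  {r | (∃ i j : Fin m, (i : ℕ) + 1 < (j : ℕ) ∧
          r = FreeGroup.of i * FreeGroup.of j * (FreeGroup.of i)⁻¹ * (FreeGroup.of j)⁻¹) ∨
       (∃ i j : Fin m, (i : ℕ) + 1 = (j : ℕ) ∧
          r = FreeGroup.of i * FreeGroup.of j * FreeGroup.of i *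
              (FreeGroup.of j * FreeGroup.of i * FreeGroup.of j)⁻¹)}

/-- Artin's braid group on `n` strands, presented by the `n-1` generators
`σ₁, …, σ_{n-1}` and the braid relations. -/
abbrev BraidGroup (n : ℕ) := PresentedGroup (braidRels (n - 1))

/-- The Artin generators of the braid group. -/
def σB (n : ℕ) (i : Fin (n - 1)) : BraidGroup n :=
  PresentedGroup.of (rels := braidRels (n - 1)) i

/-- The half twist `Δ = σ₁ (σ₂σ₁) ⋯ (σ_{n-1} ⋯ σ₁)`, the Garside element of `Bₙ`. -/
def halfTwist (n : ℕ) : BraidGroup n :=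
  ((List.finRange (n - 1)).map fun k =>
    ((((List.finRange (n - 1)).filter fun j => decide (j ≤ k)).reverse.map (σB n)).prod)).prod

/-- `𝒢` is the (left and right) Garside structure of the braid group `Bₙ`:
the positive cone is the monoid of positive braids, generated by the Artin
generators, and the Garside element is the half twist `Δ`. -/
def IsBraidGarside (n : ℕ) (𝒢 : GarsideGroup (BraidGroup n)) : Prop :=
  𝒢.pos = Submonoid.closure (Set.range (σB n)) ∧ 𝒢.Δ = halfTwist n

end Garside

namespace Garside

namespace GarsideGroup

variable {G : Type*} [Group G] (𝒢 : GarsideGroup G)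

theorem simple_compl {s : G} (h : Simple 𝒢.pos 𝒢.Δ s) : Simple 𝒢.pos 𝒢.Δ (s⁻¹ * 𝒢.Δ) := by
  refine (𝒢.divisors_Δ _).2 ⟨h.2, ?_⟩
  have : 𝒢.Δ * (s⁻¹ * 𝒢.Δ)⁻¹ = s := by group
  unfold RightDvd
  rw [this]; exact h.1

theorem simple_compl' {s : G} (h : Simple 𝒢.pos 𝒢.Δ s) : Simple 𝒢.pos 𝒢.Δ (𝒢.Δ * s⁻¹) := by
  refine ⟨((𝒢.divisors_Δ _).1 h).2, ?_⟩
  have : (𝒢.Δ * s⁻¹)⁻¹ * 𝒢.Δ = s := by group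
  unfold LeftDvd
  rw [this]; exact h.1

theorem simple_conj {s : G} (h : Simple 𝒢.pos 𝒢.Δ s) :
    Simple 𝒢.pos 𝒢.Δ (𝒢.Δ⁻¹ * s * 𝒢.Δ) := by
  have := 𝒢.simple_compl (𝒢.simple_compl h)
  simpa [mul_assoc] using this

theorem simple_conj' {s : G} (h : Simple 𝒢.pos 𝒢.Δ s) :
    Simple 𝒢.pos 𝒢.Δ (𝒢.Δ * s * 𝒢.Δ⁻¹) := by
  have := 𝒢.simple_compl' (𝒢.simple_compl' h)
  simpa [mul_assoc] using this

theorem zpow_mem_pos {k : ℤ} (h : 0 ≤ k) : 𝒢.Δ ^ k ∈ 𝒢.pos := by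
  lift k to ℕ using h
  rw [zpow_natCast]
  exact pow_mem 𝒢.Δ_pos k

theorem leftDvd_trans {a b c : G} (h₁ : LeftDvd 𝒢.pos a b) (h₂ : LeftDvd 𝒢.pos b c) :
    LeftDvd 𝒢.pos a c := by
  have := mul_mem h₁ h₂
  unfold LeftDvd
  convert this using 1; group

theorem rightDvd_trans {a b c : G} (h₁ : RightDvd 𝒢.pos a b) (h₂ : RightDvd 𝒢.pos b c) :
    RightDvd 𝒢.pos a c := by
  have := mul_mem h₂ h₁
  unfold RightDvd
  convert this using 1; group

theorem leftDvd_antisymm {a b : G} (h₁ : LeftDvd 𝒢.pos a b) (h₂ : LeftDvd 𝒢.pos b a) :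
    a = b := by
  have := 𝒢.pos_antisymm (a⁻¹ * b) h₁ (by simpa [LeftDvd] using h₂)
  exact inv_mul_eq_one.1 this

theorem rightDvd_antisymm {a b : G} (h₁ : RightDvd 𝒢.pos a b) (h₂ : RightDvd 𝒢.pos b a) :
    a = b := by
  have := 𝒢.pos_antisymm (b * a⁻¹) h₁ (by simpa [RightDvd] using h₂)
  exact (mul_inv_eq_one.1 this).symm

theorem prod_mem_pos {l : List G} (h : ∀ s ∈ l, Simple 𝒢.pos 𝒢.Δ s) : l.prod ∈ 𝒢.pos :=
  Submonoid.list_prod_mem _ fun s hs => (h s hs).1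

theorem leftNF_head (l : List G) : ∀ (a d : G), Simple 𝒢.pos 𝒢.Δ a →
    (∀ s ∈ l, Simple 𝒢.pos 𝒢.Δ s) →
    (a :: l).IsChain (fun s t => 𝒢.gcdL (s * t) 𝒢.Δ = s) →
    LeftDvd 𝒢.pos d 𝒢.Δ → LeftDvd 𝒢.pos d (a * l.prod) → LeftDvd 𝒢.pos d a := by
  induction l with
  | nil => intro a d _ _ _ _ h; simpa using h
  | cons b l ih =>
    intro a d ha hl hc hd hdl
    have hb := hl b (by simp)
    have hl' : ∀ s ∈ l, Simple 𝒢.pos 𝒢.Δ s := fun s hs => hl s (by simp [hs])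
    rw [List.isChain_cons_cons] at hc
    have e1 : LeftDvd 𝒢.pos (𝒢.lcmL d a) (a * 𝒢.Δ) := by
      apply 𝒢.lcmL_dvd
      · have := mul_mem hd (𝒢.simple_conj ha).1
        unfold LeftDvd
        convert this using 1; group
      · unfold LeftDvd
        simpa using 𝒢.Δ_pos
    have e2 : LeftDvd 𝒢.pos (𝒢.lcmL d a) (a * (b :: l).prod) := by
      apply 𝒢.lcmL_dvd _ _ _ hdl
      unfold LeftDvd
      simpa using 𝒢.prod_mem_pos hl
    have e3 := ih b (a⁻¹ * 𝒢.lcmL d a) hb hl' hc.2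
      (by unfold LeftDvd at *; simpa [mul_assoc] using e1)
      (by unfold LeftDvd at *; simpa [mul_assoc] using e2)
    have e4 : LeftDvd 𝒢.pos (𝒢.lcmL d a) (a * b) := by
      unfold LeftDvd at *; simpa [mul_assoc] using e3
    have e5 := 𝒢.dvd_gcdL _ _ _ (𝒢.leftDvd_trans (𝒢.dvd_lcmL_left d a) e4) hd
    rwa [hc.1] at e5

theorem rightNF_last (l : List G) : ∀ (a d : G), Simple 𝒢.pos 𝒢.Δ a →
    (∀ s ∈ l, Simple 𝒢.pos 𝒢.Δ s) →
    (l ++ [a]).IsChain (fun s t => 𝒢.gcdR (s * t) 𝒢.Δ = t) →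
    RightDvd 𝒢.pos d 𝒢.Δ → RightDvd 𝒢.pos d (l.prod * a) → RightDvd 𝒢.pos d a := by
  induction l using List.reverseRecOn with
  | nil => intro a d _ _ _ _ h; simpa using h
  | append_singleton l b ih =>
    intro a d ha hl hc hd hdl
    have hb := hl b (by simp)
    have hl' : ∀ s ∈ l, Simple 𝒢.pos 𝒢.Δ s := fun s hs => hl s (by simp [hs])
    rw [List.isChain_append] at hc
    have hba : 𝒢.gcdR (b * a) 𝒢.Δ = a := hc.2.2 b (by simp) a (by simp)
    have e1 : RightDvd 𝒢.pos (𝒢.lcmR d a) (𝒢.Δ * a) := by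
      apply 𝒢.lcmR_dvd
      · have := mul_mem (𝒢.simple_conj' ha).1 hd
        unfold RightDvd
        convert this using 1; group
      · unfold RightDvd
        simpa using 𝒢.Δ_pos
    have e2 : RightDvd 𝒢.pos (𝒢.lcmR d a) ((l ++ [b]).prod * a) := by
      apply 𝒢.lcmR_dvd _ _ _ hdl
      unfold RightDvd
      simpa using 𝒢.prod_mem_pos hl
    have e3 := ih b (𝒢.lcmR d a * a⁻¹) hb hl' hc.1
      (by unfold RightDvd at *; simpa [mul_assoc] using e1)
      (by unfold RightDvd at *; simpa [mul_assoc] using e2)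
    have e4 : RightDvd 𝒢.pos (𝒢.lcmR d a) (b * a) := by
      unfold RightDvd at *; simpa [mul_assoc] using e3
    have e5 := 𝒢.dvd_gcdR _ _ _ (𝒢.rightDvd_trans (𝒢.dvd_lcmR_left d a) e4) hd
    rwa [hba] at e5

theorem Δ_ne_one : 𝒢.Δ ≠ 1 := by
  intro h
  have := 𝒢.lnf_unique 1 0 1 [] [] ⟨by simp, by simp, List.isChain_nil⟩
    ⟨by simp [h], by simp, List.isChain_nil⟩
  simp at this

theorem le_of_leftNF {p k : ℤ} {l : List G} {x : G} (h : IsLeftNF 𝒢.pos 𝒢.Δ 𝒢.gcdL p l x)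
    (hk : 𝒢.Δ ^ (-k) * x ∈ 𝒢.pos) : k ≤ p := by
  obtain ⟨rfl, hl, hc⟩ := h
  by_contra hlt
  have h1 : 𝒢.Δ⁻¹ * l.prod ∈ 𝒢.pos := by
    have := mul_mem (𝒢.zpow_mem_pos (k := k - p - 1) (by omega)) hk
    convert this using 1
    rw [← mul_assoc, ← mul_assoc, ← zpow_add, ← zpow_add, ← zpow_neg_one]
    congr 2; ring
  cases l with
  | nil =>
    simp only [List.prod_nil, mul_one] at h1
    exact 𝒢.Δ_ne_one (𝒢.pos_antisymm _ 𝒢.Δ_pos h1)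
  | cons a l =>
    have ha := hl a (by simp)
    have := 𝒢.leftNF_head l a 𝒢.Δ ha.1 (fun s hs => (hl s (by simp [hs])).1) hc
      (by unfold LeftDvd; simp) (by simpa [LeftDvd] using h1)
    exact ha.2.2 (𝒢.leftDvd_antisymm ha.1.2 this)

theorem lnf_spec (x : G) : IsLeftNF 𝒢.pos 𝒢.Δ 𝒢.gcdL (𝒢.lnf x).1 (𝒢.lnf x).2 x :=
  Classical.choose_spec (𝒢.lnf_exists x)

theorem rnf_spec (x : G) : IsRightNF 𝒢.pos 𝒢.Δ 𝒢.gcdR (𝒢.rnf x).1 (𝒢.rnf x).2 x :=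
  Classical.choose_spec (𝒢.rnf_exists x)

theorem rnf_fst (x : G) : (𝒢.rnf x).1 = 𝒢.inf x :=
  (𝒢.lnf_rnf_agree x _ _ _ _ (𝒢.lnf_spec x) (𝒢.rnf_spec x)).1.symm

theorem list_conj_mem (g : G) (hg : ∀ s, Simple 𝒢.pos 𝒢.Δ s → g * s * g⁻¹ ∈ 𝒢.pos)
    (l : List G) (hl : ∀ s ∈ l, Simple 𝒢.pos 𝒢.Δ s) : g * l.prod * g⁻¹ ∈ 𝒢.pos := by
  induction l with
  | nil => simp
  | cons a l ih =>
    have := mul_mem (hg a (hl a (by simp))) (ih fun s hs => hl s (by simp [hs]))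
    convert this using 1
    simp [mul_assoc]

theorem pos_conj {g : G} (h : g ∈ 𝒢.pos) : 𝒢.Δ⁻¹ * g * 𝒢.Δ ∈ 𝒢.pos := by
  have hs := 𝒢.lnf_spec g
  have hp := 𝒢.le_of_leftNF (k := 0) hs (by simpa using h)
  have h1 := 𝒢.list_conj_mem 𝒢.Δ⁻¹ (fun s hs => by simpa using (𝒢.simple_conj hs).1) _
    (fun s h => (hs.2.1 s h).1)
  have := mul_mem (𝒢.zpow_mem_pos hp) h1
  convert this using 1
  nth_rw 1 [hs.1]
  group

theorem pos_conj' {g : G} (h : g ∈ 𝒢.pos) : 𝒢.Δ * g * 𝒢.Δ⁻¹ ∈ 𝒢.pos := by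
  have hs := 𝒢.lnf_spec g
  have hp := 𝒢.le_of_leftNF (k := 0) hs (by simpa using h)
  have h1 := 𝒢.list_conj_mem 𝒢.Δ (fun s hs => by simpa using (𝒢.simple_conj' hs).1) _
    (fun s h => (hs.2.1 s h).1)
  have := mul_mem (𝒢.zpow_mem_pos hp) h1
  convert this using 1
  nth_rw 1 [hs.1]
  group

theorem conj_mem {g : G} (h : g ∈ 𝒢.pos) (k : ℤ) : 𝒢.Δ ^ (-k) * g * 𝒢.Δ ^ k ∈ 𝒢.pos := by
  induction k using Int.induction_on with
  | zero => simpa using h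
  | succ i ih =>
    have := 𝒢.pos_conj ih
    convert this using 1
    group
  | pred i ih =>
    have := 𝒢.pos_conj' ih
    convert this using 1
    group

theorem tau_mem {g : G} (h : g ∈ 𝒢.pos) (k : ℤ) : 𝒢.tau k g ∈ 𝒢.pos := 𝒢.conj_mem h k

theorem tau_mem_iff {g : G} (k : ℤ) : 𝒢.tau k g ∈ 𝒢.pos ↔ g ∈ 𝒢.pos := by
  refine ⟨fun h => ?_, fun h => 𝒢.tau_mem h k⟩
  have := 𝒢.tau_mem h (-k)
  convert this using 1
  unfold tau; group

theorem tau_mul (k : ℤ) (a b : G) : 𝒢.tau k (a * b) = 𝒢.tau k a * 𝒢.tau k b := by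
  unfold tau; group

theorem tau_inv (k : ℤ) (a : G) : 𝒢.tau k a⁻¹ = (𝒢.tau k a)⁻¹ := by
  unfold tau; group

theorem tau_one (k : ℤ) : 𝒢.tau k 1 = 1 := by
  unfold tau; group

theorem tau_Δ (k : ℤ) : 𝒢.tau k 𝒢.Δ = 𝒢.Δ := by
  unfold tau; group

theorem tau_tau (j k : ℤ) (a : G) : 𝒢.tau j (𝒢.tau k a) = 𝒢.tau (j + k) a := by
  unfold tau; group

theorem tau_zero (a : G) : 𝒢.tau 0 a = a := by
  unfold tau; group

theorem tau_zpow_Δ (k m : ℤ) : 𝒢.tau k (𝒢.Δ ^ m) = 𝒢.Δ ^ m := by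
  unfold tau; group

theorem tau_injective (k : ℤ) : Function.Injective (𝒢.tau k) := by
  intro a b h
  have := congrArg (𝒢.tau (-k)) h
  simpa [tau_tau, tau_zero] using this

theorem tau_prod (k : ℤ) (l : List G) : 𝒢.tau k l.prod = (l.map (𝒢.tau k)).prod := by
  induction l with
  | nil => simp [tau_one]
  | cons a l ih => simp [tau_mul, ih]

theorem tau_leftDvd (k : ℤ) (a b : G) :
    LeftDvd 𝒢.pos (𝒢.tau k a) (𝒢.tau k b) ↔ LeftDvd 𝒢.pos a b := by
  unfold LeftDvd
  rw [← tau_inv, ← tau_mul, tau_mem_iff]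

theorem tau_rightDvd (k : ℤ) (a b : G) :
    RightDvd 𝒢.pos (𝒢.tau k a) (𝒢.tau k b) ↔ RightDvd 𝒢.pos a b := by
  unfold RightDvd
  rw [← tau_inv, ← tau_mul, tau_mem_iff]

theorem tau_gcdL (k : ℤ) (a b : G) :
    𝒢.tau k (𝒢.gcdL a b) = 𝒢.gcdL (𝒢.tau k a) (𝒢.tau k b) := by
  apply 𝒢.leftDvd_antisymm
  · apply 𝒢.dvd_gcdL
    · rw [tau_leftDvd]; exact 𝒢.gcdL_dvd_left _ _
    · rw [tau_leftDvd]; exact 𝒢.gcdL_dvd_right _ _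
  · rw [← 𝒢.tau_leftDvd (-k), tau_tau, neg_add_cancel, tau_zero]
    apply 𝒢.dvd_gcdL
    · rw [← 𝒢.tau_leftDvd k, tau_tau, add_neg_cancel, tau_zero]; exact 𝒢.gcdL_dvd_left _ _
    · rw [← 𝒢.tau_leftDvd k, tau_tau, add_neg_cancel, tau_zero]; exact 𝒢.gcdL_dvd_right _ _

theorem tau_gcdR (k : ℤ) (a b : G) :
    𝒢.tau k (𝒢.gcdR a b) = 𝒢.gcdR (𝒢.tau k a) (𝒢.tau k b) := by
  apply 𝒢.rightDvd_antisymm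
  · apply 𝒢.dvd_gcdR
    · rw [tau_rightDvd]; exact 𝒢.gcdR_dvd_left _ _
    · rw [tau_rightDvd]; exact 𝒢.gcdR_dvd_right _ _
  · rw [← 𝒢.tau_rightDvd (-k), tau_tau, neg_add_cancel, tau_zero]
    apply 𝒢.dvd_gcdR
    · rw [← 𝒢.tau_rightDvd k, tau_tau, add_neg_cancel, tau_zero]; exact 𝒢.gcdR_dvd_left _ _
    · rw [← 𝒢.tau_rightDvd k, tau_tau, add_neg_cancel, tau_zero]; exact 𝒢.gcdR_dvd_right _ _

/-- proper simple -/
def Proper (s : G) : Prop := Simple 𝒢.pos 𝒢.Δ s ∧ s ≠ 1 ∧ s ≠ 𝒢.Δ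

theorem tau_simple {s : G} (k : ℤ) (h : Simple 𝒢.pos 𝒢.Δ s) :
    Simple 𝒢.pos 𝒢.Δ (𝒢.tau k s) := by
  refine ⟨𝒢.tau_mem h.1 k, ?_⟩
  have := (𝒢.tau_leftDvd k s 𝒢.Δ).2 h.2
  rwa [tau_Δ] at this

theorem tau_proper {s : G} (k : ℤ) (h : 𝒢.Proper s) : 𝒢.Proper (𝒢.tau k s) := by
  refine ⟨𝒢.tau_simple k h.1, fun h1 => h.2.1 ?_, fun h1 => h.2.2 ?_⟩
  · apply 𝒢.tau_injective k; rw [h1, tau_one]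
  · apply 𝒢.tau_injective k; rw [h1, tau_Δ]

theorem le_inf_iff (k : ℤ) (x : G) : k ≤ 𝒢.inf x ↔ 𝒢.Δ ^ (-k) * x ∈ 𝒢.pos := by
  have hs := 𝒢.lnf_spec x
  refine ⟨fun h => ?_, fun h => 𝒢.le_of_leftNF hs h⟩
  have := mul_mem (𝒢.zpow_mem_pos (k := 𝒢.inf x - k) (by omega))
    (𝒢.prod_mem_pos fun s h => (hs.2.1 s h).1)
  convert this using 1
  nth_rw 1 [hs.1]
  rw [← mul_assoc, ← zpow_add]
  congr 2
  unfold inf; ring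

theorem prod_dvd_pow (l : List G) (hl : ∀ s ∈ l, Simple 𝒢.pos 𝒢.Δ s) :
    l.prod⁻¹ * 𝒢.Δ ^ (l.length : ℤ) ∈ 𝒢.pos := by
  induction l with
  | nil => simp
  | cons a l ih =>
    have h1 := ih fun s hs => hl s (by simp [hs])
    have h2 := 𝒢.conj_mem (hl a (by simp)).2 l.length
    have := mul_mem h1 h2
    convert this using 1
    simp only [List.prod_cons, List.length_cons, Nat.cast_add, Nat.cast_one]
    group

theorem length_le (m : ℕ) : ∀ l : List G, (∀ s ∈ l, 𝒢.Proper s) →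
    l.IsChain (fun s t => 𝒢.gcdL (s * t) 𝒢.Δ = s) →
    l.prod⁻¹ * 𝒢.Δ ^ m ∈ 𝒢.pos → l.length ≤ m := by
  induction m with
  | zero =>
    intro l hl _ h
    cases l with
    | nil => simp
    | cons a l =>
      exfalso
      apply (hl a (by simp)).2.1
      apply 𝒢.pos_antisymm _ (hl a (by simp)).1.1
      have := mul_mem (𝒢.prod_mem_pos (l := l) fun s hs => (hl s (by simp [hs])).1) h
      simpa using this
  | succ m ih =>
    intro l hl hc h
    cases l with
    | nil => simp
    | cons a l =>
      have hl' : ∀ s ∈ l, 𝒢.Proper s := fun s hs => hl s (by simp [hs])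
      have := ih l hl' hc.tail ?_
      · simpa using this
      have h1 := 𝒢.leftNF_head l a ((a :: l).prod * 𝒢.Δ ^ (-(m : ℤ))) (hl a (by simp)).1
        (fun s hs => (hl' s hs).1) hc ?_ ?_
      · have := 𝒢.conj_mem h1 m
        convert this using 1
        simp only [List.prod_cons, ← zpow_natCast]
        group
      · have := 𝒢.conj_mem h (-m)
        unfold LeftDvd
        convert this using 1
        simp only [List.prod_cons, ← zpow_natCast, Nat.cast_add, Nat.cast_one]
        group
      · have := 𝒢.zpow_mem_pos (k := m) (by omega)
        unfold LeftDvd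
        convert this using 1
        simp only [List.prod_cons]
        group

theorem sup_le_iff (k : ℤ) (x : G) : 𝒢.sup x ≤ k ↔ x⁻¹ * 𝒢.Δ ^ k ∈ 𝒢.pos := by
  have hs := 𝒢.lnf_spec x
  constructor
  · intro h
    have h1 := 𝒢.prod_dvd_pow (𝒢.lnf x).2 fun s h => (hs.2.1 s h).1
    have h2 := 𝒢.zpow_mem_pos (k := k - 𝒢.sup x) (by omega)
    have h3 := 𝒢.conj_mem h1 (𝒢.inf x)
    have h4 := 𝒢.conj_mem h1 0
    have := mul_mem h4 h2
    have := 𝒢.conj_mem this (0)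
    have e : x⁻¹ * 𝒢.Δ ^ k = (𝒢.lnf x).2.prod⁻¹ * 𝒢.Δ ^ (k - 𝒢.inf x) := by
      nth_rw 1 [hs.1]
      rw [show (𝒢.lnf x).1 = 𝒢.inf x from rfl]
      group
    rw [e]
    convert mul_mem h1 h2 using 1
    rw [mul_assoc, ← zpow_add]
    congr 2
    unfold sup len; ring
  · intro h
    have e : x⁻¹ * 𝒢.Δ ^ k = (𝒢.lnf x).2.prod⁻¹ * 𝒢.Δ ^ (k - 𝒢.inf x) := by
      nth_rw 1 [hs.1]
      rw [show (𝒢.lnf x).1 = 𝒢.inf x from rfl]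
      group
    rw [e] at h
    have h0 : 𝒢.inf x ≤ k := by
      by_contra hlt
      have h1 := mul_mem (𝒢.prod_mem_pos (fun s h => (hs.2.1 s h).1)) h
      rw [mul_inv_cancel_left] at h1
      have h2 := mul_mem h1 (𝒢.zpow_mem_pos (k := 𝒢.inf x - k - 1) (by omega))
      rw [← zpow_add, show k - 𝒢.inf x + (𝒢.inf x - k - 1) = -1 by ring, zpow_neg_one] at h2
      exact 𝒢.Δ_ne_one (𝒢.pos_antisymm _ 𝒢.Δ_pos h2)
    have := 𝒢.length_le (k - 𝒢.inf x).toNat (𝒢.lnf x).2 hs.2.1 hs.2.2 (by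
      rw [← zpow_natCast, Int.toNat_of_nonneg (by omega)]; exact h)
    unfold sup len
    omega

theorem inf_mul (a b : G) : 𝒢.inf a + 𝒢.inf b ≤ 𝒢.inf (a * b) := by
  rw [le_inf_iff]
  have ha := (𝒢.le_inf_iff _ a).1 le_rfl
  have hb := (𝒢.le_inf_iff _ b).1 le_rfl
  convert mul_mem (𝒢.conj_mem ha (𝒢.inf b)) hb using 1
  group

theorem sup_mul (a b : G) : 𝒢.sup (a * b) ≤ 𝒢.sup a + 𝒢.sup b := by
  rw [sup_le_iff]
  have ha := (𝒢.sup_le_iff _ a).1 le_rfl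
  have hb := (𝒢.sup_le_iff _ b).1 le_rfl
  convert mul_mem hb (𝒢.conj_mem ha (𝒢.sup b)) using 1
  group

theorem inf_pow (a : G) (m : ℕ) : m * 𝒢.inf a ≤ 𝒢.inf (a ^ m) := by
  induction m with
  | zero => rw [le_inf_iff]; simp
  | succ m ih =>
    rw [pow_succ]
    have := 𝒢.inf_mul (a ^ m) a
    push_cast
    linarith

theorem sup_pow (a : G) (m : ℕ) : 𝒢.sup (a ^ m) ≤ m * 𝒢.sup a := by
  induction m with
  | zero => rw [sup_le_iff]; simp
  | succ m ih =>
    rw [pow_succ]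
    have := 𝒢.sup_mul (a ^ m) a
    push_cast
    linarith

theorem rigid_pow {x : G} (hx : 𝒢.LeftRigid x) (m : ℕ) :
    ∃ L : List G, L.length = m * 𝒢.len x ∧ (∀ y ∈ L.getLast?, y ∈ (𝒢.lnf x).2.getLast?) ∧
      IsLeftNF 𝒢.pos 𝒢.Δ 𝒢.gcdL (m * 𝒢.inf x) L (x ^ m) := by
  have hs := 𝒢.lnf_spec x
  induction m with
  | zero => exact ⟨[], by simp, by simp, by simp, by simp, List.isChain_nil⟩
  | succ m ih =>
    obtain ⟨L, hL1, hL2, hL3, hL4, hL5⟩ := ih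
    refine ⟨L.map (𝒢.tau (𝒢.inf x)) ++ (𝒢.lnf x).2, ?_, ?_, ?_, ?_, ?_⟩
    · simp only [List.length_append, List.length_map, hL1]
      unfold len; ring
    · intro y hy
      rwa [List.getLast?_append_of_ne_nil _ hx.1] at hy
    · rw [pow_succ, hL3]
      nth_rw 2 [hs.1]
      rw [List.prod_append, ← tau_prod, show (𝒢.lnf x).1 = 𝒢.inf x from rfl]
      unfold tau
      push_cast
      group
    · intro s hs'
      rw [List.mem_append] at hs'
      rcases hs' with hs' | hs'
      · obtain ⟨s, h, rfl⟩ := List.mem_map.1 hs'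
        exact 𝒢.tau_proper _ (hL4 s h)
      · exact hs.2.1 s hs'
    · show List.IsChain _ _
      rw [List.isChain_append]
      refine ⟨?_, hs.2.2, ?_⟩
      · rw [List.isChain_map]
        refine List.IsChain.imp ?_ hL5
        intro a b h
        conv_rhs => rw [← h]
        rw [tau_gcdL, tau_mul, tau_Δ]
      · intro a ha b hb
        rw [List.getLast?_map, Option.mem_map] at ha
        obtain ⟨a, ha, rfl⟩ := ha
        have hc := hx.2.2.2
        have hc : List.IsChain _ _ := hc
        rw [List.isChain_append] at hc
        have h1 := hc.2.2 a (hL2 a ha) (𝒢.iotaL x) (by simp)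
        have h2 : 𝒢.iotaL x = 𝒢.tau (-𝒢.inf x) b := by
          unfold iotaL inf
          rw [List.headD_eq_head?_getD, hb]; rfl
        have h3 : b = 𝒢.tau (𝒢.inf x) (𝒢.iotaL x) := by
          rw [h2, tau_tau, add_neg_cancel, tau_zero]
        rw [h3]
        conv_rhs => rw [← h1]
        rw [tau_gcdL, tau_mul, tau_Δ]

theorem inf_of_NF {p : ℤ} {l : List G} {x : G} (h : IsLeftNF 𝒢.pos 𝒢.Δ 𝒢.gcdL p l x) :
    𝒢.inf x = p ∧ 𝒢.len x = l.length := by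
  have := 𝒢.lnf_unique x _ _ _ _ (𝒢.lnf_spec x) h
  exact ⟨this.1, by unfold len; rw [this.2]⟩

theorem rigid_bounds {x : G} (hx : 𝒢.LeftRigid x) {z : G} (hz : IsConj x z) :
    𝒢.inf z ≤ 𝒢.inf x ∧ 𝒢.sup x ≤ 𝒢.sup z := by
  obtain ⟨w, rfl⟩ := isConj_iff.1 hz
  have key (m : ℕ) : x ^ m = w⁻¹ * (w * x * w⁻¹) ^ m * w := by
    rw [conj_pow]; group
  constructor
  · by_contra hlt
    set C := 𝒢.inf w⁻¹ + 𝒢.inf w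
    obtain ⟨L, h1, -, h2⟩ := 𝒢.rigid_pow hx (C.natAbs + 1)
    have h3 := (𝒢.inf_of_NF h2).1
    rw [key] at h3
    have h4 := 𝒢.inf_mul (w⁻¹ * (w * x * w⁻¹) ^ (C.natAbs + 1)) w
    have h5 := 𝒢.inf_mul (w⁻¹) ((w * x * w⁻¹) ^ (C.natAbs + 1))
    have h6 := 𝒢.inf_pow (w * x * w⁻¹) (C.natAbs + 1)
    have h7 : (𝒢.inf x + 1) ≤ 𝒢.inf (w * x * w⁻¹) := by omega
    have h8 : ((C.natAbs + 1 : ℕ) : ℤ) * (𝒢.inf x + 1) ≤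
      ((C.natAbs + 1 : ℕ) : ℤ) * 𝒢.inf (w * x * w⁻¹) :=
      mul_le_mul_of_nonneg_left h7 (by positivity)
    have h9 : -C ≤ C.natAbs := by omega
    push_cast at *
    linarith
  · by_contra hlt
    set C := 𝒢.sup w⁻¹ + 𝒢.sup w
    obtain ⟨L, h1, -, h2⟩ := 𝒢.rigid_pow hx (C.natAbs + 1)
    have h3 : 𝒢.sup (x ^ (C.natAbs + 1)) = ((C.natAbs + 1 : ℕ) : ℤ) * 𝒢.sup x := by
      unfold sup
      rw [(𝒢.inf_of_NF h2).1, (𝒢.inf_of_NF h2).2, h1]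
      push_cast; ring
    rw [key] at h3
    have h4 := 𝒢.sup_mul (w⁻¹ * (w * x * w⁻¹) ^ (C.natAbs + 1)) w
    have h5 := 𝒢.sup_mul (w⁻¹) ((w * x * w⁻¹) ^ (C.natAbs + 1))
    have h6 := 𝒢.sup_pow (w * x * w⁻¹) (C.natAbs + 1)
    have h7 : 𝒢.sup (w * x * w⁻¹) ≤ 𝒢.sup x - 1 := by omega
    have h8 : ((C.natAbs + 1 : ℕ) : ℤ) * 𝒢.sup (w * x * w⁻¹) ≤
      ((C.natAbs + 1 : ℕ) : ℤ) * (𝒢.sup x - 1) :=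
      mul_le_mul_of_nonneg_left h7 (by positivity)
    have h9 : C ≤ C.natAbs := by omega
    push_cast at *
    linarith

theorem mem_SSS_iff {x : G} (hx : 𝒢.LeftRigid x) (z : G) :
    z ∈ 𝒢.SSS x ↔ IsConj x z ∧ 𝒢.inf z = 𝒢.inf x ∧ 𝒢.sup z = 𝒢.sup x := by
  constructor
  · rintro ⟨h1, h2⟩
    have h3 := h2 x (IsConj.refl x)
    have h4 := 𝒢.rigid_bounds hx h1
    refine ⟨h1, ?_⟩
    unfold sup at *
    omega
  · rintro ⟨h1, h2, h3⟩
    refine ⟨h1, fun w hw => ?_⟩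
    have h4 := 𝒢.rigid_bounds hx hw
    unfold sup at *
    omega

theorem iotaR_eq (x : G) : 𝒢.iotaR x = 𝒢.gcdR (𝒢.Δ ^ (-𝒢.inf x) * x) 𝒢.Δ := by
  have hs := 𝒢.rnf_spec x
  have hinf := 𝒢.rnf_fst x
  have e : 𝒢.Δ ^ (-𝒢.inf x) * x = 𝒢.tau (𝒢.inf x) (𝒢.rnf x).2.prod := by
    nth_rw 2 [hs.1]
    rw [hinf]; unfold tau; group
  rw [e]
  have e2 := 𝒢.tau_gcdR (𝒢.inf x) (𝒢.rnf x).2.prod 𝒢.Δ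
  rw [tau_Δ] at e2
  rw [← e2]
  unfold iotaR
  rw [hinf]
  congr 1
  obtain ⟨-, h2, h3⟩ := hs
  generalize (𝒢.rnf x).2 = l at *
  induction l using List.reverseRecOn with
  | nil =>
    simp only [List.getLast?_nil, Option.getD_none, List.prod_nil]
    apply 𝒢.rightDvd_antisymm
    · apply 𝒢.dvd_gcdR <;> unfold RightDvd
      · simp
      · simpa using 𝒢.Δ_pos
    · exact 𝒢.gcdR_dvd_left _ _
  | append_singleton l a _ =>
    simp only [List.getLast?_append, List.getLast?_singleton, Option.some_or, Option.getD_some]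
    have ha := h2 a (by simp)
    have hl : ∀ s ∈ l, Simple 𝒢.pos 𝒢.Δ s := fun s hs => (h2 s (by simp [hs])).1
    apply 𝒢.rightDvd_antisymm
    · apply 𝒢.dvd_gcdR
      · unfold RightDvd
        simpa using 𝒢.prod_mem_pos hl
      · exact ((𝒢.divisors_Δ a).1 ha.1).2
    · apply 𝒢.rightNF_last l a _ ha.1 hl h3 (𝒢.gcdR_dvd_right _ _)
      have := 𝒢.gcdR_dvd_left (l ++ [a]).prod 𝒢.Δ
      simpa using this

theorem inf_tau (k : ℤ) (x : G) : 𝒢.inf (𝒢.tau k x) = 𝒢.inf x := by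
  have h (j : ℤ) : j ≤ 𝒢.inf (𝒢.tau k x) ↔ j ≤ 𝒢.inf x := by
    rw [le_inf_iff, le_inf_iff, ← 𝒢.tau_mem_iff (g := 𝒢.Δ ^ (-j) * x) k, tau_mul, tau_zpow_Δ]
  exact le_antisymm ((h _).1 le_rfl) ((h _).2 le_rfl)

theorem iotaR_tau (k : ℤ) (x : G) : 𝒢.iotaR (𝒢.tau k x) = 𝒢.tau k (𝒢.iotaR x) := by
  rw [iotaR_eq, iotaR_eq, inf_tau, tau_gcdR, tau_mul, tau_zpow_Δ, tau_Δ]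

theorem cR_tau (k : ℤ) (x : G) : 𝒢.cR (𝒢.tau k x) = 𝒢.tau k (𝒢.cR x) := by
  unfold cR
  rw [iotaR_tau, tau_mul, tau_mul, tau_inv]

theorem cR_mem_SSS {x : G} (hx : 𝒢.LeftRigid x) {z : G} (hz : z ∈ 𝒢.SSS x) :
    𝒢.cR z ∈ 𝒢.SSS x := by
  rw [mem_SSS_iff _ hx] at hz ⊢
  obtain ⟨h1, h2, h3⟩ := hz
  have hc : IsConj x (𝒢.cR z) := h1.trans (isConj_iff.2 ⟨𝒢.iotaR z, rfl⟩)
  refine ⟨hc, ?_⟩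
  have hb := 𝒢.rigid_bounds hx hc
  have hlen : 0 < 𝒢.len x := List.length_pos_of_ne_nil hx.1
  have hi := 𝒢.iotaR_eq z
  have d1 := 𝒢.gcdR_dvd_left (𝒢.Δ ^ (-𝒢.inf z) * z) 𝒢.Δ
  have d2 := 𝒢.gcdR_dvd_right (𝒢.Δ ^ (-𝒢.inf z) * z) 𝒢.Δ
  rw [← hi] at d1 d2
  have ipos : 𝒢.iotaR z ∈ 𝒢.pos := by
    have : RightDvd 𝒢.pos 1 (𝒢.iotaR z) := by
      rw [hi]
      apply 𝒢.dvd_gcdR <;> unfold RightDvd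
      · simpa using (𝒢.le_inf_iff _ z).1 le_rfl
      · simpa using 𝒢.Δ_pos
    simpa [RightDvd] using this
  have isim : Simple 𝒢.pos 𝒢.Δ (𝒢.iotaR z) := (𝒢.divisors_Δ _).2 ⟨ipos, d2⟩
  constructor
  · apply le_antisymm hb.1
    rw [← h2, le_inf_iff]
    convert mul_mem (𝒢.conj_mem ipos (𝒢.inf z)) d1 using 1
    unfold cR; group
  · refine le_antisymm ?_ hb.2
    rw [← h3, sup_le_iff]
    have hz' := (𝒢.sup_le_iff _ z).1 le_rfl
    have hA : RightDvd 𝒢.pos (𝒢.Δ ^ (-(𝒢.sup z - 𝒢.inf z - 1)) * (𝒢.Δ ^ (-𝒢.inf z) * z))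
        (𝒢.iotaR z) := by
      rw [hi]
      apply 𝒢.dvd_gcdR <;> unfold RightDvd
      · have := 𝒢.zpow_mem_pos (k := 𝒢.sup z - 𝒢.inf z - 1) (by unfold sup at *; omega)
        convert this using 1; group
      · convert 𝒢.conj_mem hz' (-1) using 1; group
    have h6 := 𝒢.conj_mem isim.2 (𝒢.sup z - 1)
    convert mul_mem hA h6 using 1
    unfold cR; group

theorem cR_iter_mem_SSS {x : G} (hx : 𝒢.LeftRigid x) {z : G} (hz : z ∈ 𝒢.SSS x) (i : ℕ) :
    (𝒢.cR)^[i] z ∈ 𝒢.SSS x := by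
  induction i with
  | zero => exact hz
  | succ i ih => rw [Function.iterate_succ_apply']; exact 𝒢.cR_mem_SSS hx ih

theorem trans_pos {x z v : G} (hv : v ∈ 𝒢.pos) (h : v * x * v⁻¹ = z)
    (hinf : 𝒢.inf x = 𝒢.inf z) : 𝒢.iotaR z * v * (𝒢.iotaR x)⁻¹ ∈ 𝒢.pos := by
  have d1 := 𝒢.gcdR_dvd_left (𝒢.Δ ^ (-𝒢.inf x) * x) 𝒢.Δ
  have d2 := 𝒢.gcdR_dvd_right (𝒢.Δ ^ (-𝒢.inf x) * x) 𝒢.Δ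
  rw [← iotaR_eq] at d1 d2
  have key : RightDvd 𝒢.pos (𝒢.iotaR x * v⁻¹) (𝒢.iotaR z) := by
    rw [𝒢.iotaR_eq z]
    apply 𝒢.dvd_gcdR <;> unfold RightDvd
    · convert mul_mem (𝒢.conj_mem hv (𝒢.inf x)) d1 using 1
      rw [← h, ← hinf] at *
      rw [← hinf]
      group
    · convert mul_mem (𝒢.conj_mem hv (-1)) d2 using 1
      group
  unfold RightDvd at key
  convert key using 1
  group

theorem trans_simple {x z v : G} (hv : Simple 𝒢.pos 𝒢.Δ v) (h : v * x * v⁻¹ = z)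
    (hinf : 𝒢.inf x = 𝒢.inf z) : Simple 𝒢.pos 𝒢.Δ (𝒢.iotaR z * v * (𝒢.iotaR x)⁻¹) := by
  refine (𝒢.divisors_Δ _).2 ⟨𝒢.trans_pos hv.1 h hinf, ?_⟩
  have h1 := 𝒢.trans_pos (x := z) (z := 𝒢.tau (-1) x) (𝒢.simple_compl' hv).1
    (by rw [← h]; unfold tau; group) (by rw [inf_tau, hinf])
  unfold RightDvd
  convert h1 using 1
  rw [iotaR_tau]
  unfold tau; group

theorem trans_iter {x : G} (hx : 𝒢.LeftRigid x) {u v s : G} (hu : u ∈ 𝒢.SSS x)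
    (hv : v ∈ 𝒢.SSS x) (hs : Simple 𝒢.pos 𝒢.Δ s) (h : s * v * s⁻¹ = u) (i : ℕ) :
    Simple 𝒢.pos 𝒢.Δ (𝒢.transRIter v i s) ∧
    𝒢.transRIter v i s * ((𝒢.cR)^[i] v) * (𝒢.transRIter v i s)⁻¹ = (𝒢.cR)^[i] u := by
  induction i with
  | zero => exact ⟨hs, h⟩
  | succ i ih =>
    obtain ⟨h1, h2⟩ := ih
    rw [Function.iterate_succ_apply', Function.iterate_succ_apply']
    show Simple 𝒢.pos 𝒢.Δ (𝒢.transR _ _) ∧ 𝒢.transR _ _ * _ * (𝒢.transR _ _)⁻¹ = _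
    unfold transR
    rw [h2]
    constructor
    · apply 𝒢.trans_simple h1 h2
      have a := (𝒢.mem_SSS_iff hx _).1 (𝒢.cR_iter_mem_SSS hx hu i)
      have b := (𝒢.mem_SSS_iff hx _).1 (𝒢.cR_iter_mem_SSS hx hv i)
      rw [a.2.1, b.2.1]
    · generalize (𝒢.cR)^[i] u = a at *
      generalize (𝒢.cR)^[i] v = b at *
      unfold cR
      subst h2
      group

/-- rigid list -/
def RL (p : ℤ) (l : List G) : Prop :=
  (∀ s ∈ l, 𝒢.Proper s) ∧
    ∀ a ∈ l.getLast?, (𝒢.tau p a :: l).IsChain (fun s t => 𝒢.gcdR (s * t) 𝒢.Δ = t)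

theorem cR_of_NF {p : ℤ} {l : List G} {a y : G}
    (h : IsRightNF 𝒢.pos 𝒢.Δ 𝒢.gcdR p (l ++ [a]) y) :
    𝒢.cR y = (𝒢.tau p a :: l).prod * 𝒢.Δ ^ p := by
  have h1 := 𝒢.rnf_unique y _ _ _ _ (𝒢.rnf_spec y) h
  have h2 : 𝒢.iotaR y = 𝒢.tau p a := by
    unfold iotaR
    rw [h1.1, h1.2]
    simp
  unfold cR
  rw [h2, h.1]
  simp only [List.prod_append, List.prod_cons, List.prod_nil]
  unfold tau
  group

theorem RL_NF {p : ℤ} {l : List G} (h : 𝒢.RL p l) :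
    IsRightNF 𝒢.pos 𝒢.Δ 𝒢.gcdR p l (l.prod * 𝒢.Δ ^ p) := by
  refine ⟨rfl, h.1, ?_⟩
  cases hl : l.getLast? with
  | none => rw [List.getLast?_eq_none_iff.1 hl]; exact List.isChain_nil
  | some a => exact (h.2 a hl).tail

theorem RL_step {p : ℤ} {l : List G} {a : G} (h : 𝒢.RL p (l ++ [a])) :
    𝒢.RL p (𝒢.tau p a :: l) := by
  constructor
  · intro s hs
    rcases List.mem_cons.1 hs with rfl | hs
    · exact 𝒢.tau_proper p (h.1 a (by simp))
    · exact h.1 s (by simp [hs])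
  · intro b hb
    have hc := h.2 a (by simp)
    rw [← List.cons_append, List.isChain_append] at hc
    have h1 := hc.2.2 b hb a (by simp)
    rw [List.isChain_cons_cons]
    refine ⟨?_, hc.1⟩
    conv_rhs => rw [← h1]
    rw [tau_gcdR, tau_mul, tau_Δ]

theorem RL_iter {p : ℤ} (l₂ : List G) : ∀ l₁ : List G, 𝒢.RL p (l₁ ++ l₂) →
    (𝒢.cR)^[l₂.length] ((l₁ ++ l₂).prod * 𝒢.Δ ^ p) =
      (l₂.map (𝒢.tau p) ++ l₁).prod * 𝒢.Δ ^ p := by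
  induction l₂ using List.reverseRecOn with
  | nil => intro l₁ _; simp
  | append_singleton l a ih =>
    intro l₁ h
    rw [← List.append_assoc] at h ⊢
    have := ih (𝒢.tau p a :: l₁) (by simpa using 𝒢.RL_step h)
    rw [List.length_append, List.length_singleton, Function.iterate_succ_apply,
      𝒢.cR_of_NF (𝒢.RL_NF h)]
    rw [List.cons_append] at this
    rw [this]
    simp

theorem rigid_cycle {y : G} (hy : 𝒢.RightRigid y) :
    (𝒢.cR)^[(𝒢.rnf y).2.length] y = 𝒢.tau (𝒢.rnf y).1 y := by
  have hs := 𝒢.rnf_spec y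
  have hRL : 𝒢.RL (𝒢.rnf y).1 ([] ++ (𝒢.rnf y).2) := by
    refine ⟨hs.2.1, ?_⟩
    intro a ha
    have := hy.2.2.2
    have e : 𝒢.iotaR y = 𝒢.tau (𝒢.rnf y).1 a := by
      unfold iotaR
      rw [List.nil_append] at ha
      rw [ha]; rfl
    rw [e] at this
    exact this
  have := 𝒢.RL_iter _ _ hRL
  rw [List.nil_append, List.append_nil, ← hs.1, ← tau_prod] at this
  rw [this]
  have e := congrArg (𝒢.tau (𝒢.rnf y).1) hs.1
  rw [tau_mul, tau_zpow_Δ] at e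
  exact e.symm

theorem rigid_periodic {y : G} (hy : 𝒢.RightRigid y) {k : ℕ} (hk : 1 ≤ k)
    (hc : ∀ g : G, 𝒢.tau k g = g) : ∃ t : ℕ, 1 ≤ t ∧ (𝒢.cR)^[t] y = y := by
  have hl : 1 ≤ (𝒢.rnf y).2.length := List.length_pos_of_ne_nil hy.1
  refine ⟨(𝒢.rnf y).2.length * k, Nat.mul_pos hl hk, ?_⟩
  have h (j : ℕ) : (𝒢.cR)^[(𝒢.rnf y).2.length * j] y = 𝒢.tau (j * (𝒢.rnf y).1) y := by
    induction j with
    | zero => simp [tau_zero]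
    | succ j ih =>
      rw [Nat.mul_succ, add_comm, Function.iterate_add_apply, ih]
      have hcomm : Function.Commute 𝒢.cR (𝒢.tau (j * (𝒢.rnf y).1)) := fun z => 𝒢.cR_tau _ z
      rw [(hcomm.iterate_left _).eq, 𝒢.rigid_cycle hy, tau_tau]
      congr 1
      push_cast; ring
  rw [h]
  have hz (i : ℤ) : ∀ g : G, 𝒢.tau (k * i) g = g := by
    have hneg : ∀ g : G, 𝒢.tau (-k) g = g := fun g => by
      conv_lhs => rw [← hc g]
      rw [tau_tau, neg_add_cancel, tau_zero]
    induction i using Int.induction_on with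
    | zero => intro g; simp [tau_zero]
    | succ i ih => intro g; rw [mul_add, mul_one, ← tau_tau, hc, ih]
    | pred i ih => intro g; rw [mul_sub, mul_one, sub_eq_add_neg, ← tau_tau, hneg, ih]
  exact hz _ y

end GarsideGroup

/-- exponent sum -/
def expSum (n : ℕ) : BraidGroup n →* Multiplicative ℤ :=
  PresentedGroup.toGroup (rels := braidRels (n - 1)) (f := fun _ => Multiplicative.ofAdd (1 : ℤ))
    (by
      rintro r (⟨i, j, -, rfl⟩ | ⟨i, j, -, rfl⟩) <;> simp)

theorem expSum_σ (n : ℕ) (i : Fin (n - 1)) : expSum n (σB n i) = Multiplicative.ofAdd (1 : ℤ) :=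
  PresentedGroup.toGroup.of _

theorem pos_exp {n : ℕ} {g : BraidGroup n}
    (h : g ∈ Submonoid.closure (Set.range (σB n))) :
    (0 ≤ (expSum n g).toAdd) ∧ ((expSum n g).toAdd = 0 → g = 1) ∧
      ((expSum n g).toAdd = 1 → g ∈ Set.range (σB n)) := by
  induction h using Submonoid.closure_induction with
  | mem x hx =>
    obtain ⟨i, rfl⟩ := hx
    rw [expSum_σ]
    simp
  | one => simp
  | mul x y _ _ hx hy =>
    rw [map_mul, toAdd_mul]
    refine ⟨by omega, fun h => ?_, fun h => ?_⟩
    · rw [hx.2.1 (by omega), hy.2.1 (by omega), one_mul]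
    · rcases (show (expSum n x).toAdd = 0 ∨ (expSum n y).toAdd = 0 by omega) with h0 | h0
      · rw [hx.2.1 h0, one_mul]; exact hy.2.2 (by omega)
      · rw [hy.2.1 h0, mul_one]; exact hx.2.2 (by omega)

theorem exists_central {n : ℕ} (𝒢 : GarsideGroup (BraidGroup n)) (h𝒢 : IsBraidGarside n 𝒢) :
    ∃ k : ℕ, 1 ≤ k ∧ ∀ g, 𝒢.tau k g = g := by
  classical
  have hmem (i : Fin (n - 1)) : 𝒢.tau 1 (σB n i) ∈ Set.range (σB n) := by
    have h1 : 𝒢.tau 1 (σB n i) ∈ 𝒢.pos := by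
      apply 𝒢.tau_mem
      rw [h𝒢.1]
      exact Submonoid.subset_closure ⟨i, rfl⟩
    rw [h𝒢.1] at h1
    apply (pos_exp h1).2.2
    unfold GarsideGroup.tau
    simp [expSum_σ]
  let S := Set.range (σB n)
  let f : S → S := fun a => ⟨𝒢.tau 1 a.1, by obtain ⟨_, i, rfl⟩ := a; exact hmem i⟩
  have hf : Function.Injective f := by
    intro a b h
    exact Subtype.ext (𝒢.tau_injective 1 (congrArg Subtype.val h))
  have hfin : Finite S := Set.finite_range (σB n)
  let e : Equiv.Perm S := Equiv.ofBijective f (Finite.injective_iff_bijective.1 hf)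
  refine ⟨orderOf e, orderOf_pos e, ?_⟩
  have hpow (j : ℕ) (a : S) : (((e ^ j) a : S) : BraidGroup n) = 𝒢.tau j a := by
    induction j with
    | zero => simp [GarsideGroup.tau_zero]
    | succ j ih =>
      rw [pow_succ', Equiv.Perm.mul_apply]
      show 𝒢.tau 1 ((e ^ j) a).1 = _
      rw [ih, GarsideGroup.tau_tau]
      congr 1; push_cast; ring
  have hσ (i : Fin (n - 1)) : 𝒢.tau (orderOf e) (σB n i) = σB n i := by
    have := hpow (orderOf e) ⟨σB n i, i, rfl⟩
    rw [pow_orderOf_eq_one] at this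
    exact this.symm
  let F : BraidGroup n →* BraidGroup n :=
    { toFun := 𝒢.tau (orderOf e), map_one' := 𝒢.tau_one _, map_mul' := 𝒢.tau_mul _ }
  have hF : F = MonoidHom.id _ := by
    apply PresentedGroup.ext
    intro i
    exact hσ i
  intro g
  exact DFunLike.congr_fun hF g

end Garside

namespace Garside

/-- **Proposition 4.13.** Let `x ∈ Bₙ` be a left rigid braid with
`ℓ(x) = r > 1`. Then `Φ` (given on vertices by `Φ(y) = c_R^{2rt}(y)` and on
arrows by iterated right transport) is a well-defined map of directed graphs
from `USG_L(x)` to `USG_R(x)^op`: for every arrow labeled `s` from `u` to `v`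
in `USG_L(x)` and every `t` such that `c_R^{2rt}(u)` and `c_R^{2rt}(v)` are
right rigid, the iterated right transport `Φ(s) = s^{(2rt)}_R` is a simple
element satisfying `Φ(s)·Φ(v)·Φ(s)⁻¹ = Φ(u)`, i.e. an arrow from `Φ(v)` to
`Φ(u)` in `USG_R(x)`, hence an arrow from `Φ(u)` to `Φ(v)` in `USG_R(x)^op`. -/
theorem Phi_map_of_graphs {n : ℕ} (𝒢 : GarsideGroup (BraidGroup n))
    (h𝒢 : IsBraidGarside n 𝒢) (x : BraidGroup n) (r : ℕ)
    (hr : 𝒢.len x = r) (hr1 : 1 < r) (hx : 𝒢.LeftRigid x)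
    (u v s : BraidGroup n) (hu : u ∈ 𝒢.USSL x) (hv : v ∈ 𝒢.USSL x)
    (hs : Simple 𝒢.pos 𝒢.Δ s) (harr : s⁻¹ * u * s = v)
    (t : ℕ) (hru : 𝒢.RightRigid ((𝒢.cR)^[2 * r * t] u))
    (hrv : 𝒢.RightRigid ((𝒢.cR)^[2 * r * t] v)) :
    Simple 𝒢.pos 𝒢.Δ (𝒢.transRIter v (2 * r * t) s) ∧
    𝒢.transRIter v (2 * r * t) s * ((𝒢.cR)^[2 * r * t] v) *
        (𝒢.transRIter v (2 * r * t) s)⁻¹ = (𝒢.cR)^[2 * r * t] u ∧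
    (𝒢.cR)^[2 * r * t] u ∈ 𝒢.USSR x ∧ (𝒢.cR)^[2 * r * t] v ∈ 𝒢.USSR x := by
  have h1 := 𝒢.trans_iter hx hu.1 hv.1 hs (by rw [← harr]; group) (2 * r * t)
  obtain ⟨k, hk, hc⟩ := exists_central 𝒢 h𝒢
  exact ⟨h1.1, h1.2, ⟨𝒢.cR_iter_mem_SSS hx hu.1 _, 𝒢.rigid_periodic hru hk hc⟩,
    ⟨𝒢.cR_iter_mem_SSS hx hv.1 _, 𝒢.rigid_periodic hrv hk hc⟩⟩

end Garside
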